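/- arXiv:1212.1488 — 2 statements merged into one kernel-verified Lean document; each statement's English description precedes it below -/
import Mathlib

section
/- Let $A$ be a constant real $k\times k$ matrix such that every solution of $\dot x = Ax$ is bounded on $[0,+\infty)$, and let $B : [0,+\infty) \to \mathbb{R}^{k\times k}$ be continuous with $\int_0^\infty \|B(t)\|\,dt < \infty$. Then every solution of the perturbed linear system $\dot y = (A + B(t))\,y$ is bounded on $[0,+\infty)$. -/
open Matrix MeasureTheory

attribute [local instance] Matrix.linftyOpNormedAddCommGroup

theorem aux_exp_deriv {E : Type*} [NormedAddCommGroup E] [NormedSpace ℝ E] [CompleteSpace E]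
    (L : E →L[ℝ] E) (t : ℝ) :
    HasDerivAt (fun t : ℝ => NormedSpace.exp (t • L)) (NormedSpace.exp (t • L) * L) t :=
  hasDerivAt_exp_smul_const (𝕂 := ℝ) L t

theorem aux_exp_deriv' {E : Type*} [NormedAddCommGroup E] [NormedSpace ℝ E] [CompleteSpace E]
    (L : E →L[ℝ] E) (t : ℝ) :
    HasDerivAt (fun t : ℝ => NormedSpace.exp (t • L)) (L * NormedSpace.exp (t • L)) t :=
  hasDerivAt_exp_smul_const' (𝕂 := ℝ) L t

theorem aux_bound {E : Type*} [NormedAddCommGroup E] [NormedSpace ℝ E] [CompleteSpace E]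
    (L : E →L[ℝ] E)
    (hA : ∀ x : ℝ → E, (∀ t : ℝ, HasDerivAt x (L (x t)) t) →
      ∃ C : ℝ, ∀ t : ℝ, 0 ≤ t → ‖x t‖ ≤ C) :
    ∃ M : ℝ, 0 ≤ M ∧ ∀ t : ℝ, 0 ≤ t → ∀ v, ‖NormedSpace.exp (t • L) v‖ ≤ M * ‖v‖ := by
  obtain ⟨C, hC⟩ := banach_steinhaus (g := fun t : Set.Ici (0:ℝ) => NormedSpace.exp (t.1 • L)) (by
    intro v
    obtain ⟨C, hC⟩ := hA (fun t => NormedSpace.exp (t • L) v) (fun t => by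
      have := (aux_exp_deriv' L t).clm_apply (hasDerivAt_const t v)
      simpa using this)
    exact ⟨C, fun t => hC t.1 t.2⟩)
  refine ⟨C, (norm_nonneg _).trans (hC ⟨0, le_refl (0:ℝ)⟩), fun t ht v => ?_⟩
  exact ContinuousLinearMap.le_of_opNorm_le _ (hC ⟨t, ht⟩) v

theorem aux_main {E : Type*} [NormedAddCommGroup E] [NormedSpace ℝ E] [CompleteSpace E]
    (L : E →L[ℝ] E) (M : ℝ) (hM : 0 ≤ M)
    (hL : ∀ t : ℝ, 0 ≤ t → ∀ v, ‖NormedSpace.exp (t • L) v‖ ≤ M * ‖v‖)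
    (b : ℝ → ℝ) (hb : Continuous b) (hb0 : ∀ t, 0 ≤ b t) (I : ℝ)
    (hI : ∀ t, 0 ≤ t → ∫ s in (0:ℝ)..t, b s ≤ I)
    (y z : ℝ → E) (hy : ∀ t, 0 ≤ t → HasDerivAt y (L (y t) + z t) t)
    (hz : ∀ t, 0 ≤ t → ‖z t‖ ≤ b t * ‖y t‖) :
    ∃ C : ℝ, ∀ t : ℝ, 0 ≤ t → ‖y t‖ ≤ C := by
  set u : ℝ → ℝ := fun t => ‖y (max t 0)‖ with hu
  have hyc : ContinuousOn y (Set.Ici 0) := fun t ht => (hy t ht).continuousAt.continuousWithinAt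
  have huc : Continuous u :=
    (hyc.comp_continuous (by fun_prop) (fun t => le_max_right t 0)).norm
  have hfc : Continuous (fun s => M * (b s * u s)) := by fun_prop
  set R : ℝ → ℝ := fun t => M * ‖y 0‖ + ∫ s in (0:ℝ)..t, M * (b s * u s) with hR
  have hRd : ∀ t, HasDerivAt R (M * (b t * u t)) t := fun t =>
    (hfc.integral_hasStrictDerivAt 0 t).hasDerivAt.const_add _
  have key : ∀ T, 0 ≤ T → ‖y T‖ ≤ R T := by
    intro T hT
    have hg : ∀ s, 0 ≤ s → HasDerivAt (fun s => NormedSpace.exp ((T - s) • L) (y s))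
        (NormedSpace.exp ((T - s) • L) (z s)) s := by
      intro s hs
      have h1 : HasDerivAt (fun s : ℝ => T - s) (-1) s := by
        simpa using (hasDerivAt_id s).const_sub T
      have h2 := ((aux_exp_deriv L (T - s)).scomp s h1).clm_apply (hy s hs)
      refine h2.congr_deriv ?_
      simp
    have h := image_norm_le_of_norm_deriv_right_le_deriv_boundary
      (f := fun s => NormedSpace.exp ((T - s) • L) (y s)) (a := 0) (b := T)
      (f' := fun s => NormedSpace.exp ((T - s) • L) (z s))
      (fun s hs => (hg s hs.1).continuousAt.continuousWithinAt)
      (fun s hs => (hg s hs.1).hasDerivWithinAt) (B := R) (B' := fun t => M * (b t * u t))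
      (by simpa [hR] using hL T hT (y 0)) hRd
      (by
        intro s hs
        refine (hL _ (by linarith [hs.2]) _).trans ?_
        have := hz s hs.1
        have e : u s = ‖y s‖ := by simp [hu, max_eq_left hs.1]
        rw [e]
        gcongr)
      (Set.right_mem_Icc.2 hT)
    simpa using h
  set β : ℝ → ℝ := fun t => ∫ s in (0:ℝ)..t, b s with hβ
  have hβd : ∀ t, HasDerivAt β (b t) t := fun t => (hb.integral_hasStrictDerivAt 0 t).hasDerivAt
  have hd : ∀ t, HasDerivAt (fun t => R t * Real.exp (-(M * β t)))
      (M * (b t * u t) * Real.exp (-(M * β t)) +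
        R t * (Real.exp (-(M * β t)) * (-(M * b t)))) t := fun t =>
    (hRd t).mul (((hβd t).const_mul M).neg.exp)
  have hanti : AntitoneOn (fun t => R t * Real.exp (-(M * β t))) (Set.Ici 0) := by
    apply antitoneOn_of_deriv_nonpos (convex_Ici 0)
      (fun t _ => (hd t).continuousAt.continuousWithinAt)
      (fun t _ => (hd t).differentiableAt.differentiableWithinAt)
    intro t ht
    rw [interior_Ici] at ht
    have ht : 0 ≤ t := le_of_lt ht
    rw [(hd t).deriv]
    have e : u t = ‖y t‖ := by simp [hu, max_eq_left ht]
    have h1 := key t ht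
    have h2 : 0 ≤ (R t - u t) * (M * b t * Real.exp (-(M * β t))) := by
      rw [e]
      have := hb0 t
      have := sub_nonneg.2 h1
      positivity
    linarith
  refine ⟨M * ‖y 0‖ * Real.exp (M * I), fun t ht => (key t ht).trans ?_⟩
  have h := hanti (Set.self_mem_Ici) (Set.mem_Ici.2 ht) ht
  have h0 : R 0 = M * ‖y 0‖ := by simp [hR]
  have h0' : β 0 = 0 := by simp [hβ]
  simp only [h0, h0', mul_zero, neg_zero, Real.exp_zero, mul_one] at h
  calc R t = R t * Real.exp (-(M * β t)) * Real.exp (M * β t) := by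
        rw [mul_assoc, ← Real.exp_add]; simp
    _ ≤ M * ‖y 0‖ * Real.exp (M * I) := by
        have := hI t ht
        gcongr

/-- If every solution of the constant-coefficient linear system `ẋ = Ax` is
bounded on `[0, ∞)`, and `B : [0,∞) → ℝ^{k×k}` is continuous with `∫₀^∞ ‖B(t)‖ dt < ∞`,
then every solution of the perturbed system `ẏ = (A + B(t)) y` is bounded on `[0, ∞)`. -/
theorem perturbed_linear_system_bounded
    (k : ℕ) (A : Matrix (Fin k) (Fin k) ℝ)
    (hA : ∀ x : ℝ → Fin k → ℝ,
      (∀ t : ℝ, HasDerivAt x (A.mulVec (x t)) t) →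
      ∃ C : ℝ, ∀ t : ℝ, 0 ≤ t → ‖x t‖ ≤ C)
    (B : ℝ → Matrix (Fin k) (Fin k) ℝ)
    (hBcont : ContinuousOn B (Set.Ici (0 : ℝ)))
    (hBint : IntegrableOn (fun t => ‖B t‖) (Set.Ici (0 : ℝ)))
    (y : ℝ → Fin k → ℝ)
    (hy : ∀ t : ℝ, 0 ≤ t → HasDerivAt y ((A + B t).mulVec (y t)) t) :
    ∃ C : ℝ, ∀ t : ℝ, 0 ≤ t → ‖y t‖ ≤ C := by
  obtain ⟨M, hM, hL⟩ := aux_bound (LinearMap.toContinuousLinearMap A.mulVecLin)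
    (fun x hx => hA x (fun t => by simpa using hx t))
  have hbc : Continuous (fun t => ‖B (max t 0)‖) :=
    (hBcont.comp_continuous (by fun_prop) (fun t => le_max_right t 0)).norm
  refine aux_main _ M hM hL (fun t => ‖B (max t 0)‖) hbc (fun t => norm_nonneg _)
    (∫ t in Set.Ici (0:ℝ), ‖B t‖) ?_ y (fun t => (B t).mulVec (y t)) ?_ ?_
  · intro t ht
    rw [intervalIntegral.integral_of_le ht]
    rw [setIntegral_congr_fun (g := fun t => ‖B t‖) measurableSet_Ioc
      (fun s hs => by simp [max_eq_left hs.1.le])]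
    refine setIntegral_mono_set hBint (Filter.Eventually.of_forall fun _ => norm_nonneg _) ?_
    exact Filter.Eventually.of_forall (fun s hs => hs.1.le)
  · intro t ht
    simpa [Matrix.add_mulVec] using hy t ht
  · intro t ht
    simpa [max_eq_left ht] using Matrix.linfty_opNorm_mulVec (B t) (y t)
end

section
/- Let $A$ be a constant real $k\times k$ matrix all of whose eigenvalues have strictly negative real part (equivalently, every solution of $\dot x = Ax$ tends to $0$ as $t \to \infty$), and let $B : [0,+\infty) \to \mathbb{R}^{k\times k}$ be continuous with $\int_0^\infty \|B(t)\|\,dt < \infty$. Then every solution $y$ of the perturbed linear system $\dot y = (A + B(t))\,y$ satisfies $y(t) \to 0$ as $t \to \infty$. -/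
open Matrix MeasureTheory

attribute [local instance] Matrix.linftyOpNormedAddCommGroup

section aux
open Filter Topology

attribute [local instance] Matrix.linftyOpNormedRing Matrix.linftyOpNormedAlgebra

lemma aux_scalar (n : ℕ) (μ : ℂ) (hμ : μ.re < 0) :
    Tendsto (fun t : ℝ => Complex.exp ((t : ℂ) * μ) * (t : ℂ) ^ n) atTop (𝓝 0) := by
  rw [tendsto_zero_iff_norm_tendsto_zero]
  have h := tendsto_rpow_mul_exp_neg_mul_atTop_nhds_zero (n : ℝ) (-μ.re) (by linarith)
  refine h.congr' ?_
  filter_upwards [eventually_ge_atTop 0] with t ht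
  rw [norm_mul, Complex.norm_exp, norm_pow, Complex.norm_real, Real.norm_of_nonneg ht,
    Real.rpow_natCast, mul_comm]
  congr 2
  simp [mul_comm]

lemma aux_gen {k : ℕ} (A : Matrix (Fin k) (Fin k) ℂ) (μ : ℂ) (hμ : μ.re < 0) (n : ℕ)
    (v : Fin k → ℂ) (hv : ((A - μ • 1) ^ n) *ᵥ v = 0) :
    Tendsto (fun t : ℝ => NormedSpace.exp ((t : ℂ) • A) *ᵥ v) atTop (𝓝 0) := by
  set N := A - μ • (1 : Matrix (Fin k) (Fin k) ℂ) with hN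
  have hz : ∀ m, n ≤ m → (N ^ m) *ᵥ v = 0 := by
    intro m hm
    obtain ⟨d, rfl⟩ := Nat.exists_eq_add_of_le' hm
    rw [pow_add, ← Matrix.mulVec_mulVec, hv, Matrix.mulVec_zero]
  have key : ∀ t : ℝ, NormedSpace.exp ((t : ℂ) • A) *ᵥ v
      = ∑ j ∈ Finset.range n, (Complex.exp ((t : ℂ) * μ) * (t : ℂ) ^ j) •
          (((j.factorial : ℂ)⁻¹) • ((N ^ j) *ᵥ v)) := by
    intro t
    have h1 : (t : ℂ) • A = ((t : ℂ) * μ) • (1 : Matrix (Fin k) (Fin k) ℂ) + (t : ℂ) • N := by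
      rw [hN, smul_sub, smul_smul]; abel
    have h2 : NormedSpace.exp (((t : ℂ) * μ) • (1 : Matrix (Fin k) (Fin k) ℂ))
        = Complex.exp ((t : ℂ) * μ) • (1 : Matrix (Fin k) (Fin k) ℂ) := by
      rw [← Matrix.diagonal_one, ← Matrix.diagonal_smul, Matrix.exp_diagonal,
        ← Matrix.diagonal_smul]
      congr 1
      ext i
      simp [Complex.exp_eq_exp_ℂ, Pi.coe_exp]
    have h3 : NormedSpace.exp ((t : ℂ) • N) *ᵥ v
        = ∑ j ∈ Finset.range n, ((t : ℂ) ^ j) • (((j.factorial : ℂ)⁻¹) • ((N ^ j) *ᵥ v)) := by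
      have hs := NormedSpace.exp_series_hasSum_exp' (𝕂 := ℂ) ((t : ℂ) • N)
      have hs2 := hs.map (⟨⟨fun M : Matrix (Fin k) (Fin k) ℂ => M *ᵥ v, by simp⟩,
        fun a b => Matrix.add_mulVec a b v⟩ : Matrix (Fin k) (Fin k) ℂ →+ (Fin k → ℂ))
        (by
          change Continuous (fun M : Matrix (Fin k) (Fin k) ℂ => M *ᵥ v)
          fun_prop)
      have hs3 : HasSum (fun j : ℕ => ((t : ℂ) ^ j) • (((j.factorial : ℂ)⁻¹) • ((N ^ j) *ᵥ v)))
          (NormedSpace.exp ((t : ℂ) • N) *ᵥ v) := by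
        refine hs2.congr_fun ?_ 
        intro j
        change _ = ((j.factorial : ℂ)⁻¹ • ((t : ℂ) • N) ^ j) *ᵥ v
        rw [smul_pow, smul_mulVec, smul_mulVec, smul_comm]
      refine hs3.unique (hasSum_sum_of_ne_finset_zero ?_)
      intro j hj
      rw [hz j (by simpa using hj)]; simp
    rw [h1, Matrix.exp_add_of_commute _ _ ((Commute.one_left _).smul_left _), h2,
      smul_mul_assoc, one_mul, smul_mulVec, h3, Finset.smul_sum]
    simp_rw [smul_smul, mul_assoc]
  simp_rw [key]
  rw [← Finset.sum_const_zero (s := Finset.range n)]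
  refine tendsto_finsetSum _ fun j _ => ?_
  have := (aux_scalar j μ hμ).smul_const (((j.factorial : ℂ)⁻¹) • ((N ^ j) *ᵥ v))
  simpa using this

lemma aux_complex {k : ℕ} (A : Matrix (Fin k) (Fin k) ℂ)
    (hA : ∀ μ ∈ spectrum ℂ A, μ.re < 0) (v : Fin k → ℂ) :
    Tendsto (fun t : ℝ => NormedSpace.exp ((t : ℂ) • A) *ᵥ v) atTop (𝓝 0) := by
  have hv : v ∈ ⨆ μ, (Module.End.maxGenEigenspace (Matrix.toLin' A) μ) := by
    rw [Module.End.iSup_maxGenEigenspace_eq_top]; trivial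
  refine Submodule.iSup_induction _ (motive := fun v : Fin k → ℂ => Tendsto
    (fun t : ℝ => NormedSpace.exp ((t : ℂ) • A) *ᵥ v) atTop (𝓝 0)) hv ?_ ?_ ?_
  · intro μ v hv
    rw [Module.End.mem_maxGenEigenspace] at hv
    obtain ⟨n, hn⟩ := hv
    by_cases h0 : v = 0
    · simp [h0]
    have hev : Module.End.HasEigenvalue (Matrix.toLin' A) μ := by
      apply Module.End.hasEigenvalue_of_hasGenEigenvalue (k := n)
      intro hbot
      apply h0
      have : v ∈ (Module.End.genEigenspace (Matrix.toLin' A) μ n) := by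
        rw [Module.End.mem_genEigenspace_nat]; exact hn
      rw [hbot] at this
      simpa using this
    have hμ := hA μ (by
      rw [← Matrix.spectrum_toLin']; exact Module.End.hasEigenvalue_iff_mem_spectrum.1 hev)
    refine aux_gen A μ hμ n v ?_
    have : Matrix.toLin' ((A - μ • 1) ^ n) = (Matrix.toLin' A - μ • 1) ^ n := by
      rw [Matrix.toLin'_pow, map_sub, map_smul, Matrix.toLin'_one]; rfl
    rw [← Matrix.toLin'_apply, this]; exact hn
  · simp
  · intro x y hx hy
    simp_rw [Matrix.mulVec_add]
    simpa using hx.add hy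

lemma aux_real {k : ℕ} (A : Matrix (Fin k) (Fin k) ℝ)
    (hA : ∀ μ ∈ spectrum ℂ (A.map (fun x : ℝ => (x : ℂ))), μ.re < 0) (i j : Fin k) :
    Tendsto (fun t : ℝ => NormedSpace.exp (t • A) i j) atTop (𝓝 0) := by
  have h := aux_complex _ hA (Pi.single j 1)
  rw [tendsto_pi_nhds] at h
  have h2 := h i
  have h3 : ∀ t : ℝ, (NormedSpace.exp ((t : ℂ) • (A.map (fun x : ℝ => (x : ℂ)))) *ᵥ
      (Pi.single j 1)) i = ((NormedSpace.exp (t • A) i j : ℝ) : ℂ) := by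
    intro t
    have hm := NormedSpace.map_exp (Complex.ofRealHom.mapMatrix (m := Fin k))
      (by
        change Continuous (fun M : Matrix (Fin k) (Fin k) ℝ => M.map Complex.ofRealHom)
        exact Continuous.matrix_map continuous_id Complex.continuous_ofReal) (t • A)
    have he : Complex.ofRealHom.mapMatrix (t • A) = (t : ℂ) • (A.map (fun x : ℝ => (x : ℂ))) := by
      ext a b; simp
    have hm2 : NormedSpace.exp ((t : ℂ) • (A.map (fun x : ℝ => (x : ℂ))))
        = (NormedSpace.exp (t • A)).map (fun x : ℝ => (x : ℂ)) := by
      rw [← he]; exact hm.symm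
    rw [hm2]
    simp
  simp_rw [h3] at h2
  exact_mod_cast (Complex.continuous_re.tendsto _).comp h2

lemma aux_deriv {k : ℕ} (A : Matrix (Fin k) (Fin k) ℝ) (r : ℝ) (i j : Fin k) :
    HasDerivAt (fun u : ℝ => NormedSpace.exp (u • A) i j)
      ((NormedSpace.exp (r • A) * A) i j) r := by
  have h := hasDerivAt_exp_smul_const A r
  exact (LinearMap.toContinuousLinearMap (Matrix.entryLinearMap ℝ ℝ i j)).hasFDerivAt.comp_hasDerivAt r h

end aux

section core
open Filter Topology

lemma aux_core {k : ℕ} (A : Matrix (Fin k) (Fin k) ℝ) (E : ℝ → Matrix (Fin k) (Fin k) ℝ)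
    (hE0 : E 0 = 1)
    (hEd : ∀ r i j, HasDerivAt (fun u => E u i j) ((E r * A) i j) r)
    (hEt : ∀ i j, Tendsto (fun t => E t i j) atTop (𝓝 0))
    (B : ℝ → Matrix (Fin k) (Fin k) ℝ)
    (hBcont : ContinuousOn B (Set.Ici (0 : ℝ)))
    (hBint : IntegrableOn (fun t => ‖B t‖) (Set.Ici (0 : ℝ)))
    (y : ℝ → Fin k → ℝ)
    (hy : ∀ t : ℝ, 0 ≤ t → HasDerivAt y ((A + B t).mulVec (y t)) t) :
    Tendsto y atTop (𝓝 0) := by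
  have hEc : Continuous E := by
    refine continuous_pi fun i => continuous_pi fun j => ?_
    exact continuous_iff_continuousAt.2 fun r => (hEd r i j).continuousAt
  have hEz : Tendsto E atTop (𝓝 0) :=
    tendsto_pi_nhds.2 fun i => tendsto_pi_nhds.2 fun j => hEt i j
  have hyc : ContinuousOn y (Set.Ici 0) := fun t ht => (hy t ht).continuousAt.continuousWithinAt
  -- bound on the propagator
  obtain ⟨M, hM1, hM⟩ : ∃ M : ℝ, 1 ≤ M ∧ ∀ t, 0 ≤ t → ‖E t‖ ≤ M := by
    have h1 : ∀ᶠ t in atTop, ‖E t‖ ≤ 1 := by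
      have := (tendsto_zero_iff_norm_tendsto_zero.1 hEz)
      exact this.eventually_le_const one_pos
    obtain ⟨T, hT⟩ := eventually_atTop.1 h1
    obtain ⟨C, hC⟩ := (isCompact_Icc (a := (0 : ℝ)) (b := T)).exists_bound_of_continuousOn
      hEc.continuousOn
    refine ⟨max 1 C, le_max_left _ _, fun t ht => ?_⟩
    rcases le_total t T with h | h
    · exact (hC t ⟨ht, h⟩).trans (le_max_right _ _)
    · exact (hT t h).trans (le_max_left _ _)
  have hii : ∀ s t, 0 ≤ s → 0 ≤ t → IntervalIntegrable (fun r => ‖B r‖) volume s t := by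
    intro s t hs ht
    refine ContinuousOn.intervalIntegrable (hBcont.norm.mono ?_)
    intro r hr
    exact (le_min hs ht).trans hr.1
  -- variation of constants
  have voc : ∀ s t K, 0 ≤ s → s ≤ t → 0 ≤ K → (∀ r ∈ Set.Icc s t, ‖y r‖ ≤ K) →
      ‖y t‖ ≤ ‖E (t - s)‖ * ‖y s‖ + M * K * ∫ r in s..t, ‖B r‖ := by
    intro s t K hs hst hK hyK
    have hd : ∀ r ∈ Set.uIcc s t, HasDerivAt (fun r => E (t - r) *ᵥ y r)
        (E (t - r) *ᵥ (B r *ᵥ y r)) r := by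
      intro r hr
      rw [Set.uIcc_of_le hst] at hr
      have hyr := hasDerivAt_pi.1 (hy r (hs.trans hr.1))
      have hEr : ∀ i j, HasDerivAt (fun u => E (t - u) i j) (-((E (t - r) * A) i j)) r := by
        intro i j
        have := (hEd (t - r) i j).scomp r ((hasDerivAt_id r).const_sub t)
        simpa [Function.comp_def] using this
      rw [hasDerivAt_pi]
      intro i
      have hsum := HasDerivAt.fun_sum (u := Finset.univ) fun j _ => (hEr i j).mul (hyr j)
      refine hsum.congr_deriv ?_
      have : E (t - r) *ᵥ (B r *ᵥ y r)
          = -((E (t - r) * A) *ᵥ y r) + E (t - r) *ᵥ ((A + B r) *ᵥ y r) := by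
        rw [Matrix.add_mulVec, Matrix.mulVec_add, Matrix.mulVec_mulVec]; simp
      rw [this, Finset.sum_add_distrib]
      simp only [neg_mul, Finset.sum_neg_distrib]
      rfl
    have hcont : ContinuousOn (fun r => E (t - r) *ᵥ (B r *ᵥ y r)) (Set.uIcc s t) := by
      rw [Set.uIcc_of_le hst]
      have hsub : Set.Icc s t ⊆ Set.Ici 0 := fun r hr => hs.trans hr.1
      have h1 := hBcont.mono hsub
      have h2 := hyc.mono hsub
      have h3 : ContinuousOn (fun r => E (t - r)) (Set.Icc s t) :=
        (hEc.comp (continuous_const.sub continuous_id)).continuousOn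
      have hmv : ∀ (F : ℝ → Matrix (Fin k) (Fin k) ℝ) (z : ℝ → Fin k → ℝ),
          ContinuousOn F (Set.Icc s t) → ContinuousOn z (Set.Icc s t) →
          ContinuousOn (fun r => F r *ᵥ z r) (Set.Icc s t) := by
        intro F z hF hz
        rw [continuousOn_iff_continuous_domRestrict] at *
        exact Continuous.matrix_mulVec hF hz
      exact hmv _ _ h3 (hmv _ _ h1 h2)
    have hint := intervalIntegral.integral_eq_sub_of_hasDerivAt hd hcont.intervalIntegrable
    simp only [sub_self, hE0, Matrix.one_mulVec] at hint
    have hbd : ‖∫ r in s..t, E (t - r) *ᵥ (B r *ᵥ y r)‖ ≤ ∫ r in s..t, M * K * ‖B r‖ := by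
      refine intervalIntegral.norm_integral_le_of_norm_le hst (ae_of_all _ fun r hr => ?_)
        ((hii s t hs (hs.trans hst)).const_mul _)
      calc ‖E (t - r) *ᵥ (B r *ᵥ y r)‖ ≤ ‖E (t - r)‖ * (‖B r‖ * ‖y r‖) :=
            (Matrix.linfty_opNorm_mulVec _ _).trans
              (mul_le_mul_of_nonneg_left (Matrix.linfty_opNorm_mulVec _ _) (norm_nonneg _))
        _ ≤ M * (‖B r‖ * K) := by
            gcongr
            · exact hM _ (by linarith [hr.2])
            · exact hyK r ⟨hr.1.le, hr.2⟩
        _ = M * K * ‖B r‖ := by ring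
    rw [intervalIntegral.integral_const_mul] at hbd
    have : y t = E (t - s) *ᵥ y s + ∫ r in s..t, E (t - r) *ᵥ (B r *ᵥ y r) := by
      rw [hint]; abel
    rw [this]
    exact (norm_add_le _ _).trans (add_le_add (Matrix.linfty_opNorm_mulVec _ _) hbd)
  -- tails of the integral
  have tail : ∀ ε : ℝ, 0 < ε → ∃ S : ℝ, 0 ≤ S ∧ ∀ s t, S ≤ s → s ≤ t →
      ∫ r in s..t, ‖B r‖ ≤ ε := by
    intro ε hε
    have hl := intervalIntegral_tendsto_integral_Ioi (0 : ℝ)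
      (hBint.mono_set Set.Ioi_subset_Ici_self) tendsto_id
    obtain ⟨S, hS⟩ := (Metric.tendsto_atTop.1 hl) (ε / 2) (by positivity)
    refine ⟨max S 0, le_max_right _ _, fun s t hs hst => ?_⟩
    have hs0 := (le_max_right _ _).trans hs
    have hsS := (le_max_left _ _).trans hs
    have a := hS s hsS
    have b := hS t (hsS.trans hst)
    rw [Real.dist_eq, abs_lt] at a b
    have c := intervalIntegral.integral_interval_sub_left (hii 0 t le_rfl (hs0.trans hst))
      (hii 0 s le_rfl hs0)
    simp only [id] at a b
    linarith [a.1, a.2, b.1, b.2]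
  -- boundedness
  obtain ⟨S₀, hS₀, K, hK0, hK⟩ : ∃ S₀ : ℝ, 0 ≤ S₀ ∧ ∃ K : ℝ, 0 ≤ K ∧ ∀ t, S₀ ≤ t → ‖y t‖ ≤ K := by
    obtain ⟨S, hS0, hS⟩ := tail (1 / (2 * M)) (by positivity)
    refine ⟨S, hS0, 2 * M * ‖y S‖, by positivity, fun t ht => ?_⟩
    obtain ⟨p, hp, hpm⟩ := (isCompact_Icc (a := S) (b := t)).exists_isMaxOn ⟨S, le_rfl, ht⟩
      (hyc.norm.mono fun r hr => hS0.trans hr.1)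
    have h1 := voc S p ‖y p‖ hS0 hp.1 (norm_nonneg _)
      (fun r hr => hpm ⟨hr.1, hr.2.trans hp.2⟩)
    have h2 : M * ‖y p‖ * ∫ r in S..p, ‖B r‖ ≤ M * ‖y p‖ * (1 / (2 * M)) := by
      gcongr
      exact hS S p le_rfl hp.1
    have h3 : M * ‖y p‖ * (1 / (2 * M)) = ‖y p‖ / 2 := by field_simp
    have h4 : ‖E (p - S)‖ * ‖y S‖ ≤ M * ‖y S‖ := by
      gcongr
      exact hM _ (by linarith [hp.1])
    have h5 : ‖y t‖ ≤ ‖y p‖ := hpm ⟨ht, le_rfl⟩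
    linarith
  rw [tendsto_zero_iff_norm_tendsto_zero, Metric.tendsto_atTop]
  intro ε hε
  obtain ⟨S, hS0, hS⟩ := tail (ε / (2 * (M * (K + 1)))) (by positivity)
  set s := max S S₀
  have hs0 : 0 ≤ s := hS0.trans (le_max_left _ _)
  have hlim : Tendsto (fun t => ‖E (t - s)‖ * ‖y s‖) atTop (𝓝 0) := by
    have h1 : Tendsto (fun t : ℝ => t - s) atTop atTop := tendsto_atTop_add_const_right _ _ tendsto_id
    have h2 := ((tendsto_zero_iff_norm_tendsto_zero.1 hEz).comp h1).mul_const ‖y s‖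
    simpa [Function.comp_def] using h2
  obtain ⟨T, hT⟩ := eventually_atTop.1 (hlim.eventually_lt_const (half_pos hε))
  refine ⟨max T s, fun t ht => ?_⟩
  have hts : s ≤ t := (le_max_right _ _).trans ht
  have h1 := voc s t (K + 1) hs0 hts (by positivity)
    (fun r hr => (hK r ((le_max_right _ _).trans hr.1)).trans (by linarith))
  have h2 : M * (K + 1) * ∫ r in s..t, ‖B r‖ ≤ M * (K + 1) * (ε / (2 * (M * (K + 1)))) := by
    gcongr
    exact hS s t (le_max_left _ _) hts
  have h3 : M * (K + 1) * (ε / (2 * (M * (K + 1)))) = ε / 2 := by field_simp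
  have h4 := hT t ((le_max_left _ _).trans ht)
  rw [Real.dist_eq, sub_zero, abs_of_nonneg (norm_nonneg _)]
  linarith

end core

/-- If all eigenvalues of the constant matrix `A` have strictly negative
real part, and `B : [0,∞) → ℝ^{k×k}` is continuous with `∫₀^∞ ‖B(t)‖ dt < ∞`, then every
solution of the perturbed system `ẏ = (A + B(t)) y` tends to `0` as `t → ∞`. -/
theorem perturbed_hurwitz_system_tendsto_zero
    (k : ℕ) (A : Matrix (Fin k) (Fin k) ℝ)
    (hA : ∀ μ ∈ spectrum ℂ (A.map (fun x : ℝ => (x : ℂ))), μ.re < 0)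
    (B : ℝ → Matrix (Fin k) (Fin k) ℝ)
    (hBcont : ContinuousOn B (Set.Ici (0 : ℝ)))
    (hBint : IntegrableOn (fun t => ‖B t‖) (Set.Ici (0 : ℝ)))
    (y : ℝ → Fin k → ℝ)
    (hy : ∀ t : ℝ, 0 ≤ t → HasDerivAt y ((A + B t).mulVec (y t)) t) :
    Filter.Tendsto y Filter.atTop (nhds 0) := by
  exact aux_core A (fun t => NormedSpace.exp (t • A)) (by simp) (aux_deriv A) (aux_real A hA)
    B hBcont hBint y hy
end
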